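/- arXiv:1305.1036 — 7 statements merged into one kernel-verified Lean document; each statement's English description precedes it below -/
import Mathlib

section
/- Let p ≥ 1 and let (μ_g, β_g, Σ_g), g = 1, …, G, be pairwise distinct triples, where μ_g, β_g ∈ ℝ^p and each Σ_g is a real symmetric p×p matrix. Then there exists z ∈ ℝ^p such that the triples (⟨μ_g, z⟩, ⟨β_g, z⟩, zᵀ Σ_g z), g = 1, …, G, are pairwise distinct. -/
open Matrix

/-- Finitely many nonzero polynomials over an infinite domain have a common non-root. -/
theorem MvPolynomial.exists_forall_eval_ne_zero {R σ ι : Type*} [CommRing R] [IsDomain R]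
    [Infinite R] (s : Finset ι) (P : ι → MvPolynomial σ R) (hP : ∀ i ∈ s, P i ≠ 0) :
    ∃ z : σ → R, ∀ i ∈ s, eval z (P i) ≠ 0 := by
  by_contra! h
  refine Finset.prod_ne_zero_iff.mpr hP (MvPolynomial.funext fun z => ?_)
  obtain ⟨i, hi, hz⟩ := h z
  rw [map_prod, map_zero]
  exact Finset.prod_eq_zero hi hz

/-- A symmetric matrix is zero if its quadratic form vanishes identically. -/
theorem Matrix.IsSymm.eq_zero_of_forall_dotProduct_mulVec {n R : Type*} [Fintype n] [CommRing R]
    [IsDomain R] [NeZero (2 : R)] {A : Matrix n n R} (hA : A.IsSymm)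
    (h : ∀ z, z ⬝ᵥ A *ᵥ z = 0) : A = 0 := by
  classical
  ext i j
  have hi := h (Pi.single i 1)
  have hj := h (Pi.single j 1)
  have hij := h (Pi.single i 1 + Pi.single j 1)
  have hs := hA.apply i j
  simp only [mulVec_add, dotProduct_add, add_dotProduct, single_one_dotProduct,
    mulVec_single_one, col_apply] at hi hj hij
  rw [hi, hj, hs] at hij
  have h2 : (2 : R) * A i j = 0 := by linear_combination hij
  exact (mul_eq_zero.mp h2).resolve_left two_ne_zero

/-- The linear form of a vector, as a polynomial. -/
theorem MvPolynomial.exists_eval_eq_dotProduct {n R : Type*} [Fintype n] [CommRing R]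
    (v : n → R) : ∃ P : MvPolynomial n R, ∀ z, eval z P = v ⬝ᵥ z :=
  ⟨∑ i, C (v i) * X i, fun z => by simp [dotProduct]⟩

/-- The quadratic form of a matrix, as a polynomial. -/
theorem MvPolynomial.exists_eval_eq_dotProduct_mulVec {n R : Type*} [Fintype n] [CommRing R]
    (A : Matrix n n R) : ∃ P : MvPolynomial n R, ∀ z, eval z P = z ⬝ᵥ A *ᵥ z :=
  ⟨∑ i, X i * ∑ j, C (A i j) * X j, fun z => by simp [dotProduct, mulVec]⟩

/-- Two distinct triples of two vectors and a symmetric matrix are separated by every direction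
outside the zero set of some nonzero polynomial. -/
theorem MvPolynomial.exists_ne_zero_separating_triples {n R : Type*} [Fintype n] [CommRing R]
    [IsDomain R] [NeZero (2 : R)] {a a' b b' : n → R} {A A' : Matrix n n R}
    (hA : A.IsSymm) (hA' : A'.IsSymm) (hne : (a, b, A) ≠ (a', b', A')) :
    ∃ P : MvPolynomial n R, P ≠ 0 ∧ ∀ z, eval z P ≠ 0 →
      (a ⬝ᵥ z, b ⬝ᵥ z, z ⬝ᵥ A *ᵥ z) ≠ (a' ⬝ᵥ z, b' ⬝ᵥ z, z ⬝ᵥ A' *ᵥ z) := by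
  obtain ⟨P, hP⟩ := exists_eval_eq_dotProduct (a - a')
  obtain ⟨Q, hQ⟩ := exists_eval_eq_dotProduct (b - b')
  obtain ⟨S, hS⟩ := exists_eval_eq_dotProduct_mulVec (A - A')
  by_cases hP0 : P = 0
  · by_cases hQ0 : Q = 0
    · refine ⟨S, ?_, fun z hz h => hz ?_⟩
      · rintro rfl
        subst hP0 hQ0
        refine hne (Prod.ext ?_ (Prod.ext ?_ ?_))
        · exact sub_eq_zero.mp (dotProduct_eq_zero _ fun z => by simpa using (hP z).symm)
        · exact sub_eq_zero.mp (dotProduct_eq_zero _ fun z => by simpa using (hQ z).symm)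
        · exact sub_eq_zero.mp ((hA.sub hA').eq_zero_of_forall_dotProduct_mulVec
            fun z => by simpa using (hS z).symm)
      · rw [hS, sub_mulVec, dotProduct_sub, sub_eq_zero]
        exact congrArg (fun t => t.2.2) h
    · refine ⟨Q, hQ0, fun z hz h => hz ?_⟩
      rw [hQ, sub_dotProduct, sub_eq_zero]
      exact congrArg (fun t => t.2.1) h
  · refine ⟨P, hP0, fun z hz h => hz ?_⟩
    rw [hP, sub_dotProduct, sub_eq_zero]
    exact congrArg (fun t => t.1) h

/-- Given pairwise distinct triples `(μ g, β g, Sig g)` of locations, skewness vectors, and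
symmetric scale matrices, there is a single direction `z` such that the projected triples
`(⟨μ g, z⟩, ⟨β g, z⟩, zᵀ Sig g z)` are pairwise distinct. -/
theorem exists_direction_separating_triples
    (p G : ℕ) (hp : 1 ≤ p)
    (μ β : Fin G → (Fin p → ℝ))
    (Sig : Fin G → Matrix (Fin p) (Fin p) ℝ)
    (hsym : ∀ g, (Sig g).IsSymm)
    (hdist : Function.Injective (fun g => (μ g, β g, Sig g))) :
    ∃ z : Fin p → ℝ, Function.Injective
      (fun g => (μ g ⬝ᵥ z, β g ⬝ᵥ z, z ⬝ᵥ (Sig g) *ᵥ z)) := by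
  have hsep (q : Fin G × Fin G) (hq : q.1 ≠ q.2) :=
    MvPolynomial.exists_ne_zero_separating_triples (hsym q.1) (hsym q.2) (hdist.ne hq)
  choose! P hP0 hP using hsep
  obtain ⟨z, hz⟩ := MvPolynomial.exists_forall_eval_ne_zero
    (Finset.univ.filter fun q : Fin G × Fin G => q.1 ≠ q.2) P (by simpa using hP0)
  refine ⟨z, fun g h hgh => ?_⟩
  by_contra hne
  exact hP (g, h) hne z (hz (g, h) (by simpa using hne)) hgh
end

section
/- For all ψ > 0, χ > 0 and λ ∈ ℝ, ∫₀^∞ w^{λ−1} exp(−(ψ w + χ/w)/2) dw = 2 (χ/ψ)^{λ/2} K(λ, √(ψχ)). -/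
open MeasureTheory Real

/-- The modified Bessel function of the third kind (Watson's integral representation). -/
noncomputable def besselK (lam ω : ℝ) : ℝ :=
  ∫ t in Set.Ioi (0 : ℝ), Real.exp (-ω * Real.cosh t) * Real.cosh (lam * t)

/-- Substitution `y = exp x` in integrals over the whole positive half-line. -/
theorem integral_exp_mul_comp_exp (g : ℝ → ℝ) :
    ∫ x, Real.exp x * g (Real.exp x) = ∫ y in Set.Ioi (0 : ℝ), g y := by
  rw [← Real.range_exp, ← Set.image_univ, integral_image_eq_integral_abs_deriv_smul
    MeasurableSet.univ (fun x _ ↦ (Real.hasDerivAt_exp x).hasDerivWithinAt)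
    Real.exp_injective.injOn g]
  simp

theorem sq_div_four_le_cosh (t : ℝ) : t ^ 2 / 4 ≤ Real.cosh t := by
  have h := Real.quadratic_le_exp_of_nonneg (abs_nonneg t)
  rw [← Real.cosh_abs, Real.cosh_eq]
  nlinarith [Real.exp_pos (-|t|), sq_abs t, abs_nonneg t]

theorem integrable_exp_neg_mul_cosh_mul_exp (lam : ℝ) {ω : ℝ} (hω : 0 < ω) :
    Integrable fun t : ℝ ↦ Real.exp (-ω * Real.cosh t) * Real.exp (lam * t) := by
  have hgauss := ((integrable_exp_neg_mul_sq (b := ω / 4) (by positivity)).comp_sub_right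
    (2 * lam / ω)).const_mul (Real.exp (lam ^ 2 / ω))
  refine hgauss.mono' (by fun_prop) (Filter.Eventually.of_forall fun t ↦ ?_)
  rw [Real.norm_of_nonneg (by positivity), ← Real.exp_add, ← Real.exp_add, Real.exp_le_exp]
  have hsq : lam ^ 2 / ω + -(ω / 4) * (t - 2 * lam / ω) ^ 2 = lam * t - ω * (t ^ 2 / 4) := by
    field_simp
    ring
  rw [hsq]
  linarith [mul_le_mul_of_nonneg_left (sq_div_four_le_cosh t) hω.le]

theorem integral_exp_neg_mul_cosh_mul_exp (lam : ℝ) {ω : ℝ} (hω : 0 < ω) :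
    ∫ t, Real.exp (-ω * Real.cosh t) * Real.exp (lam * t) = 2 * besselK lam ω := by
  have hreflect : ∫ t, Real.exp (-ω * Real.cosh t) * Real.exp (-lam * t)
      = ∫ t, Real.exp (-ω * Real.cosh t) * Real.exp (lam * t) := by
    rw [← integral_neg_eq_self]
    simp
  have habs (t : ℝ) : Real.exp (-ω * Real.cosh |t|) * Real.cosh (lam * |t|)
      = (Real.exp (-ω * Real.cosh t) * Real.exp (lam * t)
        + Real.exp (-ω * Real.cosh t) * Real.exp (-lam * t)) / 2 := by
    have hcosh : Real.cosh (lam * |t|) = Real.cosh (lam * t) := by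
      rw [← Real.cosh_abs (lam * |t|), abs_mul, abs_abs, ← abs_mul, Real.cosh_abs]
    rw [Real.cosh_abs, hcosh, Real.cosh_eq (lam * t), neg_mul lam]
    ring
  rw [besselK, ← integral_comp_abs
    (f := fun t ↦ Real.exp (-ω * Real.cosh t) * Real.cosh (lam * t))]
  simp_rw [habs]
  rw [integral_div, integral_add (integrable_exp_neg_mul_cosh_mul_exp lam hω)
    (integrable_exp_neg_mul_cosh_mul_exp (-lam) hω), hreflect, add_self_div_two]

/-- Normalization of the generalized inverse Gaussian density:
`∫₀^∞ w^(λ−1) exp(−(ψw + χ/w)/2) dw = 2 (χ/ψ)^(λ/2) K(λ, √(ψχ))`. -/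
theorem gig_normalization (ψ χ lam : ℝ) (hψ : 0 < ψ) (hχ : 0 < χ) :
    ∫ w in Set.Ioi (0 : ℝ), w ^ (lam - 1) * Real.exp (-(ψ * w + χ / w) / 2)
      = 2 * (χ / ψ) ^ (lam / 2) * besselK lam (Real.sqrt (ψ * χ)) := by
  set a : ℝ := Real.log (χ / ψ) / 2 with ha
  set ω : ℝ := √(ψ * χ) with hω
  have hω_pos : 0 < ω := Real.sqrt_pos.2 (mul_pos hψ hχ)
  have hexp : Real.exp a = √(χ / ψ) := by
    rw [ha, Real.exp_half, Real.exp_log (div_pos hχ hψ)]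
  have hψa : ψ * Real.exp a = ω := by
    rw [hexp, hω, eq_comm, Real.sqrt_eq_iff_mul_self_eq (by positivity) (by positivity),
      mul_mul_mul_comm, Real.mul_self_sqrt (by positivity)]
    field_simp
  have hχa : χ / Real.exp a = ω := by
    rw [div_eq_iff (Real.exp_pos a).ne', ← hψa, mul_assoc, hexp,
      Real.mul_self_sqrt (by positivity)]
    field_simp
  have hpow : (χ / ψ) ^ (lam / 2) = Real.exp (lam * a) := by
    rw [Real.rpow_def_of_pos (div_pos hχ hψ), ha]
    ring_nf
  have hsubst (t : ℝ) : Real.exp (t + a) * (Real.exp (t + a) ^ (lam - 1)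
        * Real.exp (-(ψ * Real.exp (t + a) + χ / Real.exp (t + a)) / 2))
      = Real.exp (lam * a) * (Real.exp (-ω * Real.cosh t) * Real.exp (lam * t)) := by
    have hcosh : -(ψ * Real.exp (t + a) + χ / Real.exp (t + a)) / 2 = -ω * Real.cosh t := by
      have h₁ : ψ * Real.exp (t + a) = ω * Real.exp t := by
        rw [← hψa, Real.exp_add]
        ring
      have h₂ : χ / Real.exp (t + a) = ω * Real.exp (-t) := by
        rw [← hχa, Real.exp_add, Real.exp_neg]
        field_simp
      rw [h₁, h₂, Real.cosh_eq]
      ring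
    rw [hcosh, ← Real.exp_mul]
    simp only [← Real.exp_add]
    ring_nf
  rw [← integral_exp_mul_comp_exp, ← integral_add_right_eq_self _ a]
  simp_rw [hsubst]
  rw [integral_const_mul, integral_exp_neg_mul_cosh_mul_exp lam hω_pos, hpow]
  ring
end

section
/- Let p ≥ 1, x, μ, α ∈ ℝ^p, Δ a symmetric positive-definite p×p matrix, ψ, χ > 0 and λ ∈ ℝ. Then ∫₀^∞ φ_p(x | μ + w α, w Δ) · p(w | ψ, χ, λ) dw = f_GH(x | λ, χ, ψ, μ, Δ, α); that is, the normal mean-variance mixture X = μ + Wα + √W U with W ∼ GIG(ψ, χ, λ) and U ∼ N(0, Δ) has marginal density equal to the generalized hyperbolic density. -/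
open MeasureTheory Real Matrix

/-- The GIG density in the `(ψ, χ, λ)` parameterization. -/
noncomputable def gigDensityP (ψ χ lam w : ℝ) : ℝ :=
  (ψ / χ) ^ (lam / 2) * w ^ (lam - 1) * Real.exp (-(ψ * w + χ / w) / 2)
    / (2 * besselK lam (Real.sqrt (ψ * χ)))

/-- The squared Mahalanobis distance `δ(x, μ | Δ) = (x − μ)ᵀ Δ⁻¹ (x − μ)`. -/
noncomputable def mahalanobis {p : ℕ} (x μ : Fin p → ℝ) (Δ : Matrix (Fin p) (Fin p) ℝ) : ℝ :=
  (x - μ) ⬝ᵥ Δ⁻¹ *ᵥ (x - μ)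

/-- The multivariate Gaussian density `φ_p(x | m, S)`. -/
noncomputable def gaussianDensity {p : ℕ} (x m : Fin p → ℝ) (S : Matrix (Fin p) (Fin p) ℝ) : ℝ :=
  (2 * Real.pi) ^ (-(p : ℝ) / 2) * S.det ^ (-(1 : ℝ) / 2) *
    Real.exp (-(1 / 2) * ((x - m) ⬝ᵥ S⁻¹ *ᵥ (x - m)))

/-- The generalized hyperbolic density `f_GH(x | λ, χ, ψ, μ, Δ, α)`. -/
noncomputable def ghDensity {p : ℕ} (lam χ ψ : ℝ) (μ : Fin p → ℝ)
    (Δ : Matrix (Fin p) (Fin p) ℝ) (α : Fin p → ℝ) (x : Fin p → ℝ) : ℝ :=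
  ((χ + mahalanobis x μ Δ) / (ψ + α ⬝ᵥ Δ⁻¹ *ᵥ α)) ^ ((lam - (p : ℝ) / 2) / 2)
    * (ψ / χ) ^ (lam / 2)
    * besselK (lam - (p : ℝ) / 2)
        (Real.sqrt ((ψ + α ⬝ᵥ Δ⁻¹ *ᵥ α) * (χ + mahalanobis x μ Δ)))
    / ((2 * Real.pi) ^ ((p : ℝ) / 2) * Δ.det ^ ((1 : ℝ) / 2)
        * besselK lam (Real.sqrt (χ * ψ)) * Real.exp ((μ - x) ⬝ᵥ Δ⁻¹ *ᵥ α))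

lemma one_add_sq_div_two_le_cosh (t : ℝ) : 1 + t ^ 2 / 2 ≤ Real.cosh t := by
  have h : Real.cosh t = 1 + 2 * Real.sinh (t / 2) ^ 2 := by
    have h1 := Real.cosh_two_mul (t / 2)
    rw [mul_div_cancel₀ t two_ne_zero, Real.cosh_sq] at h1
    linarith
  have h2 : (t / 2) ^ 2 ≤ Real.sinh (t / 2) ^ 2 := by
    rw [sq_le_sq, Real.abs_sinh]
    exact Real.self_le_sinh_iff.2 (abs_nonneg _)
  rw [h]
  linarith

lemma integrable_exp_mul_sub_mul_cosh (ν : ℝ) {ω : ℝ} (hω : 0 < ω) :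
    Integrable fun t : ℝ => Real.exp (ν * t - ω * Real.cosh t) := by
  refine ((integrable_exp_neg_mul_sq (b := ω / 4) (by positivity)).const_mul
    (Real.exp (ν ^ 2 / ω))).mono' (by fun_prop) (ae_of_all _ fun t => ?_)
  rw [Real.norm_eq_abs, Real.abs_exp, ← Real.exp_add, Real.exp_le_exp]
  have h1 := mul_le_mul_of_nonneg_left (one_add_sq_div_two_le_cosh t) hω.le
  have h2 : ν ^ 2 / ω + ω * t ^ 2 / 4 - ν * t = (ν - ω * t / 2) ^ 2 / ω := by
    field_simp
    ring
  have h3 : 0 ≤ (ν - ω * t / 2) ^ 2 / ω := by positivity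
  linarith

lemma integral_exp_mul_sub_mul_cosh (ν : ℝ) {ω : ℝ} (hω : 0 < ω) :
    ∫ t : ℝ, Real.exp (ν * t - ω * Real.cosh t) = 2 * besselK ν ω := by
  have hint := integrable_exp_mul_sub_mul_cosh ν hω
  have hneg : IntegrableOn (fun t : ℝ => Real.exp (ν * -t - ω * Real.cosh (-t)))
      (Set.Ioi 0) := hint.comp_neg.integrableOn
  rw [← intervalIntegral.integral_Iic_add_Ioi (b := 0) hint.integrableOn hint.integrableOn,
    ← neg_zero, ← integral_comp_neg_Ioi, neg_zero, ← integral_add hneg hint.integrableOn,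
    besselK, ← integral_const_mul]
  refine integral_congr_ae (ae_of_all _ fun t => ?_)
  simp only [Real.cosh_neg, Real.cosh_eq (ν * t), sub_eq_add_neg, Real.exp_add, neg_mul, mul_neg]
  ring

/-- The normalizing integral of the generalized inverse Gaussian family. -/
lemma integral_rpow_mul_exp_neg_add_div (ν : ℝ) {a b : ℝ} (ha : 0 < a) (hb : 0 < b) :
    ∫ w in Set.Ioi (0 : ℝ), w ^ (ν - 1) * Real.exp (-(a * w + b / w) / 2)
      = 2 * (b / a) ^ (ν / 2) * besselK ν (Real.sqrt (a * b)) := by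
  obtain ⟨r, hr, rfl⟩ : ∃ r : ℝ, 0 < r ∧ r ^ 2 = a :=
    ⟨√a, Real.sqrt_pos.2 ha, Real.sq_sqrt ha.le⟩
  obtain ⟨s, hs, rfl⟩ : ∃ s : ℝ, 0 < s ∧ s ^ 2 = b :=
    ⟨√b, Real.sqrt_pos.2 hb, Real.sq_sqrt hb.le⟩
  have hc : 0 < s / r := by positivity
  have himage : (fun t : ℝ => s / r * Real.exp t) '' Set.univ = Set.Ioi 0 := by
    ext w
    simp only [Set.image_univ, Set.mem_range, Set.mem_Ioi]
    constructor
    · rintro ⟨t, rfl⟩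
      positivity
    · intro hw
      refine ⟨Real.log (w / (s / r)), ?_⟩
      rw [Real.exp_log (by positivity)]
      field_simp
  have hinj : Set.InjOn (fun t : ℝ => s / r * Real.exp t) Set.univ := fun t _ u _ h =>
    Real.exp_injective (mul_left_cancel₀ hc.ne' h)
  have hω : √(r ^ 2 * s ^ 2) = r * s := by
    rw [← mul_pow, Real.sqrt_sq (by positivity)]
  have hpow : (s ^ 2 / r ^ 2) ^ (ν / 2) = (s / r) ^ ν := by
    rw [← div_pow, ← Real.rpow_natCast, ← Real.rpow_mul hc.le]
    congr 1
    push_cast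
    ring
  rw [← himage, integral_image_eq_integral_abs_deriv_smul MeasurableSet.univ
    (fun t _ => ((Real.hasDerivAt_exp t).const_mul (s / r)).hasDerivWithinAt) hinj,
    setIntegral_univ, hω, hpow, mul_right_comm, mul_comm _ ((s / r) ^ ν),
    ← integral_exp_mul_sub_mul_cosh ν (by positivity), ← integral_const_mul]
  refine integral_congr_ae (ae_of_all _ fun t => ?_)
  have he : 0 < s / r * Real.exp t := by positivity
  have hexp : -(r ^ 2 * (s / r * Real.exp t) + s ^ 2 / (s / r * Real.exp t)) / 2
      = -(r * s * Real.cosh t) := by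
    rw [Real.cosh_eq, Real.exp_neg]
    field_simp
  simp only [smul_eq_mul]
  rw [abs_of_pos he, hexp, ← mul_assoc, Real.rpow_sub_one he.ne', mul_div_cancel₀ _ he.ne',
    Real.mul_rpow hc.le (Real.exp_pos t).le, ← Real.exp_mul, mul_assoc, ← Real.exp_add,
    mul_comm t ν, ← sub_eq_add_neg]

lemma dotProduct_inv_smul_mulVec_sub_smul {p : ℕ} {Δ : Matrix (Fin p) (Fin p) ℝ}
    (hΔ : IsUnit Δ.det) (hsymm : Δ.IsSymm) (d α : Fin p → ℝ) {w : ℝ} (hw : w ≠ 0) :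
    (d - w • α) ⬝ᵥ (w • Δ)⁻¹ *ᵥ (d - w • α)
      = (d ⬝ᵥ Δ⁻¹ *ᵥ d) / w - 2 * (d ⬝ᵥ Δ⁻¹ *ᵥ α) + w * (α ⬝ᵥ Δ⁻¹ *ᵥ α) := by
  have hinv : (w • Δ)⁻¹ = w⁻¹ • Δ⁻¹ := Matrix.inv_smul' Δ (Units.mk0 w hw) hΔ
  have hcomm : α ⬝ᵥ Δ⁻¹ *ᵥ d = d ⬝ᵥ Δ⁻¹ *ᵥ α := by
    rw [dotProduct_comm, dotProduct_mulVec d, ← mulVec_transpose, hsymm.inv.eq]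
  rw [hinv]
  simp only [smul_mulVec, mulVec_sub, mulVec_smul, dotProduct_smul, sub_dotProduct,
    dotProduct_sub, smul_dotProduct, smul_eq_mul, hcomm]
  field_simp
  ring

lemma gaussianDensity_add_smul {p : ℕ} (x μ α : Fin p → ℝ) {Δ : Matrix (Fin p) (Fin p) ℝ}
    (hΔ : Δ.PosDef) (hsymm : Δ.IsSymm) {w : ℝ} (hw : 0 < w) :
    gaussianDensity x (μ + w • α) (w • Δ)
      = (2 * Real.pi) ^ (-(p : ℝ) / 2) * Δ.det ^ (-(1 : ℝ) / 2)
          * Real.exp ((x - μ) ⬝ᵥ Δ⁻¹ *ᵥ α)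
          * (w ^ (-(p : ℝ) / 2)
            * Real.exp (-((α ⬝ᵥ Δ⁻¹ *ᵥ α) * w + mahalanobis x μ Δ / w) / 2)) := by
  have hdet : (w • Δ).det ^ (-(1 : ℝ) / 2) = w ^ (-(p : ℝ) / 2) * Δ.det ^ (-(1 : ℝ) / 2) := by
    rw [det_smul, Fintype.card_fin, Real.mul_rpow (by positivity) hΔ.det_pos.le,
      ← Real.rpow_natCast, ← Real.rpow_mul hw.le]
    congr 2
    ring
  have hexp : -(1 / 2) * ((x - (μ + w • α)) ⬝ᵥ (w • Δ)⁻¹ *ᵥ (x - (μ + w • α)))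
      = (x - μ) ⬝ᵥ Δ⁻¹ *ᵥ α
        + -((α ⬝ᵥ Δ⁻¹ *ᵥ α) * w + mahalanobis x μ Δ / w) / 2 := by
    rw [← sub_sub, dotProduct_inv_smul_mulVec_sub_smul hΔ.det_pos.ne'.isUnit hsymm _ _ hw.ne',
      mahalanobis]
    ring
  rw [gaussianDensity, hdet, hexp, Real.exp_add]
  ring

/-- The normal mean-variance mixture `X = μ + Wα + √W U` with `W ∼ GIG(ψ, χ, λ)` and
`U ∼ N(0, Δ)` has marginal density equal to the generalized hyperbolic density:
`∫₀^∞ φ_p(x | μ + wα, wΔ) p(w | ψ, χ, λ) dw = f_GH(x | λ, χ, ψ, μ, Δ, α)`. -/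
theorem gh_mixture_representation {p : ℕ} (hp : 1 ≤ p) (x μ α : Fin p → ℝ)
    (Δ : Matrix (Fin p) (Fin p) ℝ) (hΔ : Δ.PosDef) (hΔsym : Δ.IsSymm)
    (ψ χ lam : ℝ) (hψ : 0 < ψ) (hχ : 0 < χ) :
    ∫ w in Set.Ioi (0 : ℝ), gaussianDensity x (μ + w • α) (w • Δ) * gigDensityP ψ χ lam w
      = ghDensity lam χ ψ μ Δ α x := by
  have hψ' : 0 < ψ + α ⬝ᵥ Δ⁻¹ *ᵥ α :=
    add_pos_of_pos_of_nonneg hψ (by simpa using hΔ.inv.posSemidef.dotProduct_mulVec_nonneg α)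
  have hχ' : 0 < χ + mahalanobis x μ Δ :=
    add_pos_of_pos_of_nonneg hχ
      (by simpa only [star_trivial, mahalanobis] using
        hΔ.inv.posSemidef.dotProduct_mulVec_nonneg (x - μ))
  have hintegrand : ∀ w ∈ Set.Ioi (0 : ℝ),
      gaussianDensity x (μ + w • α) (w • Δ) * gigDensityP ψ χ lam w
        = (2 * Real.pi) ^ (-(p : ℝ) / 2) * Δ.det ^ (-(1 : ℝ) / 2)
          * Real.exp ((x - μ) ⬝ᵥ Δ⁻¹ *ᵥ α) * (ψ / χ) ^ (lam / 2)
          / (2 * besselK lam (Real.sqrt (ψ * χ)))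
          * (w ^ (lam - (p : ℝ) / 2 - 1)
            * Real.exp (-((ψ + α ⬝ᵥ Δ⁻¹ *ᵥ α) * w + (χ + mahalanobis x μ Δ) / w) / 2)) := by
    intro w hw
    rw [Set.mem_Ioi] at hw
    have hpow : w ^ (lam - (p : ℝ) / 2 - 1) = w ^ (-(p : ℝ) / 2) * w ^ (lam - 1) := by
      rw [← Real.rpow_add hw]
      congr 1
      ring
    have hexp : -((ψ + α ⬝ᵥ Δ⁻¹ *ᵥ α) * w + (χ + mahalanobis x μ Δ) / w) / 2
        = -((α ⬝ᵥ Δ⁻¹ *ᵥ α) * w + mahalanobis x μ Δ / w) / 2 + -(ψ * w + χ / w) / 2 := by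
      ring
    rw [gaussianDensity_add_smul x μ α hΔ hΔsym hw, gigDensityP, hpow, hexp, Real.exp_add]
    ring
  rw [setIntegral_congr_fun measurableSet_Ioi hintegrand, integral_const_mul,
    integral_rpow_mul_exp_neg_add_div _ hψ' hχ', ghDensity, ← neg_sub x μ, neg_dotProduct,
    Real.exp_neg, neg_div, neg_div, Real.rpow_neg (by positivity),
    Real.rpow_neg hΔ.det_pos.le, mul_comm χ ψ]
  simp only [div_eq_mul_inv, mul_inv, inv_inv]
  ring
end

section
/- Let p ≥ 1, μ, α ∈ ℝ^p, Σ a symmetric positive-definite p×p matrix, ψ, χ > 0 and λ ∈ ℝ. Then for every c > 0 and every x ∈ ℝ^p, f_GH(x | λ, χ/c, cψ, μ, cΣ, cα) = f_GH(x | λ, χ, ψ, μ, Σ, α); that is, the generalized hyperbolic density with unconstrained scale matrix is invariant under this one-parameter family of reparameterizations, so the parameterization (λ, χ, ψ, μ, Σ, α) is not identifiable. -/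
open MeasureTheory Real Matrix

lemma inv_smul_of_pos {p : ℕ} (A : Matrix (Fin p) (Fin p) ℝ) (hA : A.PosDef) {c : ℝ}
    (hc : 0 < c) : (c • A)⁻¹ = c⁻¹ • A⁻¹ := by
  have hu : IsUnit A.det := hA.det_pos.ne'.isUnit
  refine Matrix.inv_eq_right_inv ?_
  rw [Matrix.smul_mul, Matrix.mul_smul, smul_smul, mul_inv_cancel₀ hc.ne', one_smul,
    Matrix.mul_nonsing_inv _ hu]

lemma dotProduct_inv_mulVec_nonneg {p : ℕ} {A : Matrix (Fin p) (Fin p) ℝ} (hA : A.PosDef)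
    (v : Fin p → ℝ) : 0 ≤ v ⬝ᵥ A⁻¹ *ᵥ v := by
  simpa using hA.inv.posSemidef.dotProduct_mulVec_nonneg v

lemma mahalanobis_smul {p : ℕ} {A : Matrix (Fin p) (Fin p) ℝ} (hA : A.PosDef)
    (x μ : Fin p → ℝ) {c : ℝ} (hc : 0 < c) :
    mahalanobis x μ (c • A) = mahalanobis x μ A / c := by
  rw [mahalanobis, mahalanobis, inv_smul_of_pos A hA hc, Matrix.smul_mulVec, dotProduct_smul,
    smul_eq_mul, div_eq_inv_mul]

lemma inv_smul_mulVec_smul {p : ℕ} {A : Matrix (Fin p) (Fin p) ℝ} (hA : A.PosDef)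
    (v : Fin p → ℝ) {c : ℝ} (hc : 0 < c) : (c • A)⁻¹ *ᵥ (c • v) = A⁻¹ *ᵥ v := by
  rw [inv_smul_of_pos A hA hc, Matrix.smul_mulVec, Matrix.mulVec_smul, smul_smul,
    inv_mul_cancel₀ hc.ne', one_smul]

lemma div_div_mul_rpow_half {a b c : ℝ} (ha : 0 ≤ a) (hb : 0 ≤ b) (hc : 0 < c) (s : ℝ) :
    (a / c / (c * b)) ^ (s / 2) = c ^ (-s) * (a / b) ^ (s / 2) := by
  have h : a / c / (c * b) = c ^ (-2 : ℝ) * (a / b) := by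
    rw [Real.rpow_neg hc.le, Real.rpow_two, div_div, ← mul_assoc, ← sq, div_mul_eq_div_div]
    ring
  rw [h, Real.mul_rpow (by positivity) (by positivity), ← Real.rpow_mul hc.le]
  ring_nf

lemma mul_div_div_rpow_half {a b c : ℝ} (ha : 0 ≤ a) (hb : 0 ≤ b) (hc : 0 < c) (s : ℝ) :
    (c * a / (b / c)) ^ (s / 2) = c ^ s * (a / b) ^ (s / 2) := by
  have h : c * a / (b / c) = c ^ (2 : ℝ) * (a / b) := by
    rw [Real.rpow_two, div_div_eq_mul_div]
    ring
  rw [h, Real.mul_rpow (by positivity) (by positivity), ← Real.rpow_mul hc.le]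
  ring_nf

/-- The generalized hyperbolic density with unconstrained scale matrix is invariant under the
reparameterization `(λ, χ, ψ, μ, Σ, α) ↦ (λ, χ/c, cψ, μ, cΣ, cα)` for any `c > 0`, so this
parameterization is not identifiable. -/
theorem gh_scale_nonidentifiable {p : ℕ} (hp : 1 ≤ p) (μ α : Fin p → ℝ)
    (Sig : Matrix (Fin p) (Fin p) ℝ) (hSig : Sig.PosDef) (hSigSym : Sig.IsSymm)
    (ψ χ lam : ℝ) (hψ : 0 < ψ) (hχ : 0 < χ) :
    ∀ c : ℝ, 0 < c → ∀ x : Fin p → ℝ,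
      ghDensity lam (χ / c) (c * ψ) μ (c • Sig) (c • α) x = ghDensity lam χ ψ μ Sig α x := by
  intro c hc x
  have hm : 0 ≤ mahalanobis x μ Sig := dotProduct_inv_mulVec_nonneg hSig _
  have hα : 0 ≤ α ⬝ᵥ Sig⁻¹ *ᵥ α := dotProduct_inv_mulVec_nonneg hSig _
  have hχ' : χ / c + mahalanobis x μ Sig / c = (χ + mahalanobis x μ Sig) / c :=
    (add_div _ _ _).symm
  have hψ' : c * ψ + c * (α ⬝ᵥ Sig⁻¹ *ᵥ α) = c * (ψ + α ⬝ᵥ Sig⁻¹ *ᵥ α) :=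
    (mul_add _ _ _).symm
  have hcancel (a b : ℝ) : c * a * (b / c) = a * b := by field_simp
  have hcancel' (a b : ℝ) : b / c * (c * a) = b * a := by field_simp
  have hdet : (c • Sig).det ^ ((1 : ℝ) / 2) = c ^ ((p : ℝ) / 2) * Sig.det ^ ((1 : ℝ) / 2) := by
    rw [Matrix.det_smul, Fintype.card_fin, Real.mul_rpow (by positivity) hSig.det_pos.le,
      ← Real.rpow_natCast, ← Real.rpow_mul hc.le, mul_one_div]
  have hpow : c ^ (-(lam - (p : ℝ) / 2)) * c ^ lam = c ^ ((p : ℝ) / 2) := by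
    rw [← Real.rpow_add hc]
    ring_nf
  simp only [ghDensity]
  rw [mahalanobis_smul hSig x μ hc, inv_smul_mulVec_smul hSig α hc, smul_dotProduct,
    smul_eq_mul, hχ', hψ', hcancel, hcancel', hdet,
    div_div_mul_rpow_half (by positivity) (by positivity) hc,
    mul_div_div_rpow_half hψ.le hχ.le hc]
  generalize ((χ + mahalanobis x μ Sig) / (ψ + α ⬝ᵥ Sig⁻¹ *ᵥ α)) ^
    ((lam - (p : ℝ) / 2) / 2) = A
  generalize (ψ / χ) ^ (lam / 2) = B
  generalize besselK _ _ = K₁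
  generalize besselK _ _ = K₂
  rw [← mul_div_mul_left (A * B * K₁) _ (Real.rpow_pos_of_pos hc ((p : ℝ) / 2)).ne', ← hpow]
  ring
end

section
/- For every fixed ω > 0, the function λ ↦ log K(λ, ω) is strictly convex on ℝ; in particular, for every λ ∈ ℝ the Turán-type inequality K(λ, ω)² < K(λ+1, ω) · K(λ−1, ω) holds. -/
open MeasureTheory Real

theorem besselK_integrand_pos (lam ω t : ℝ) :
    0 < Real.exp (-ω * Real.cosh t) * Real.cosh (lam * t) :=
  mul_pos (Real.exp_pos _) (Real.cosh_pos _)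

theorem besselK_integrableOn (lam : ℝ) {ω : ℝ} (hω : 0 < ω) :
    IntegrableOn (fun t => Real.exp (-ω * Real.cosh t) * Real.cosh (lam * t))
      (Set.Ioi (0 : ℝ)) := by
  refine Integrable.integrableOn ?_
  refine ((integrable_exp_neg_mul_sq (b := ω / 8) (by positivity)).const_mul
    (Real.exp (2 * lam ^ 2 / ω))).mono' (by fun_prop) (ae_of_all _ fun t => ?_)
  rw [Real.norm_of_nonneg (besselK_integrand_pos lam ω t).le]
  have hcosh : Real.cosh (lam * t) ≤ Real.exp |lam * t| := by
    rw [← Real.cosh_abs, Real.cosh_eq]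
    have : Real.exp (-|lam * t|) ≤ Real.exp |lam * t| :=
      Real.exp_le_exp.2 (by linarith [abs_nonneg (lam * t)])
    linarith
  have hsq : t ^ 2 / 4 ≤ Real.cosh t := by
    rw [← Real.cosh_abs, Real.cosh_eq]
    have h := Real.quadratic_le_exp_of_nonneg (abs_nonneg t)
    have h' := Real.add_one_le_exp (-|t|)
    nlinarith [sq_abs t]
  have hmul : |lam * t| ≤ 2 * lam ^ 2 / ω + ω / 8 * t ^ 2 := by
    have h : 2 * lam ^ 2 / ω + ω / 8 * t ^ 2 - |lam * t| = 2 * (|lam| - ω / 4 * |t|) ^ 2 / ω := by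
      rw [← sq_abs lam, ← sq_abs t, abs_mul]
      field_simp
      ring
    have : 0 ≤ 2 * (|lam| - ω / 4 * |t|) ^ 2 / ω := by positivity
    linarith
  calc Real.exp (-ω * Real.cosh t) * Real.cosh (lam * t)
      ≤ Real.exp (-ω * Real.cosh t) * Real.exp |lam * t| := by gcongr
    _ ≤ Real.exp (2 * lam ^ 2 / ω) * Real.exp (-(ω / 8) * t ^ 2) := by
      rw [← Real.exp_add, ← Real.exp_add, Real.exp_le_exp]
      nlinarith [mul_le_mul_of_nonneg_left hsq hω.le]

theorem setIntegral_Ioi_pos {f : ℝ → ℝ} {c : ℝ} (hf : IntegrableOn f (Set.Ioi c))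
    (hpos : ∀ t ∈ Set.Ioi c, 0 < f t) : 0 < ∫ t in Set.Ioi c, f t := by
  rw [setIntegral_pos_iff_support_of_nonneg_ae
    (ae_restrict_of_forall_mem measurableSet_Ioi fun t ht => (hpos t ht).le) hf,
    Set.inter_eq_right.2 fun t ht => Function.mem_support.2 (hpos t ht).ne']
  simp

theorem besselK_pos (lam : ℝ) {ω : ℝ} (hω : 0 < ω) : 0 < besselK lam ω :=
  setIntegral_Ioi_pos (besselK_integrableOn lam hω) fun t _ => besselK_integrand_pos lam ω t

/-- Weighted Young inequality for `cosh`, strict away from `t = 0`. -/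
theorem cosh_mul_exp_neg_lt {x y a b t : ℝ} (p q : ℝ) (hxy : x ≠ y) (ha : 0 < a) (hb : 0 < b)
    (hab : a + b = 1) (ht : t ≠ 0) :
    Real.cosh ((a * x + b * y) * t) * Real.exp (-(a * p + b * q)) <
      a * (Real.cosh (x * t) * Real.exp (-p)) + b * (Real.cosh (y * t) * Real.exp (-q)) := by
  have key (s : ℝ) : Real.exp ((a * x + b * y) * s - (a * p + b * q)) ≤
      a * Real.exp (x * s - p) + b * Real.exp (y * s - q) := by
    have h := convexOn_exp.2 (Set.mem_univ (x * s - p)) (Set.mem_univ (y * s - q)) ha.le hb.le hab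
    simp only [smul_eq_mul] at h
    rwa [show a * (x * s - p) + b * (y * s - q) =
      (a * x + b * y) * s - (a * p + b * q) by ring] at h
  have key_lt (s : ℝ) (hs : x * s - p ≠ y * s - q) :
      Real.exp ((a * x + b * y) * s - (a * p + b * q)) <
        a * Real.exp (x * s - p) + b * Real.exp (y * s - q) := by
    have h := strictConvexOn_exp.2 (Set.mem_univ (x * s - p)) (Set.mem_univ (y * s - q)) hs
      ha hb hab
    simp only [smul_eq_mul] at h
    rwa [show a * (x * s - p) + b * (y * s - q) =
      (a * x + b * y) * s - (a * p + b * q) by ring] at h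
  have hsum : Real.exp ((a * x + b * y) * t - (a * p + b * q)) +
      Real.exp ((a * x + b * y) * -t - (a * p + b * q)) <
        (a * Real.exp (x * t - p) + b * Real.exp (y * t - q)) +
          (a * Real.exp (x * -t - p) + b * Real.exp (y * -t - q)) := by
    by_cases h : x * t - p = y * t - q
    · refine add_lt_add_of_le_of_lt (key t) (key_lt (-t) fun h' => ?_)
      exact mul_ne_zero (sub_ne_zero.2 hxy) ht (by linarith)
    · exact add_lt_add_of_lt_of_le (key_lt t h) (key (-t))
  simp only [sub_eq_add_neg, Real.exp_add, mul_neg] at hsum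
  simp only [Real.cosh_eq]
  linarith

theorem strictConvexOn_log_besselK {ω : ℝ} (hω : 0 < ω) :
    StrictConvexOn ℝ Set.univ (fun lam => Real.log (besselK lam ω)) := by
  refine ⟨convex_univ, fun x _ y _ hxy a b ha hb hab => ?_⟩
  simp only [smul_eq_mul]
  set p := Real.log (besselK x ω)
  set q := Real.log (besselK y ω)
  have hp : besselK x ω * Real.exp (-p) = 1 := by
    rw [Real.exp_neg, Real.exp_log (besselK_pos x hω), mul_inv_cancel₀ (besselK_pos x hω).ne']
  have hq : besselK y ω * Real.exp (-q) = 1 := by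
    rw [Real.exp_neg, Real.exp_log (besselK_pos y hω), mul_inv_cancel₀ (besselK_pos y hω).ne']
  have hx := (besselK_integrableOn x hω).mul_const (a * Real.exp (-p))
  have hy := (besselK_integrableOn y hω).mul_const (b * Real.exp (-q))
  have hz := (besselK_integrableOn (a * x + b * y) hω).mul_const (Real.exp (-(a * p + b * q)))
  have hpos := setIntegral_Ioi_pos ((hx.add hy).sub hz) fun t ht => by
    have h := mul_lt_mul_of_pos_left (cosh_mul_exp_neg_lt p q hxy ha hb hab (ne_of_gt ht))
      (Real.exp_pos (-ω * Real.cosh t))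
    simp only [Pi.add_apply, Pi.sub_apply]
    linarith
  rw [integral_sub' (hx.add hy) hz, integral_add' hx hy, integral_mul_const, integral_mul_const,
    integral_mul_const] at hpos
  change 0 < besselK x ω * (a * Real.exp (-p)) + besselK y ω * (b * Real.exp (-q)) -
    besselK (a * x + b * y) ω * Real.exp (-(a * p + b * q)) at hpos
  rw [mul_left_comm, hp, mul_left_comm, hq, mul_one, mul_one, hab, sub_pos, Real.exp_neg,
    ← div_eq_mul_inv, div_lt_one (Real.exp_pos _)] at hpos
  exact (Real.log_lt_iff_lt_exp (besselK_pos _ hω)).2 hpos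

/-- For fixed `ω > 0`, `λ ↦ log K(λ, ω)` is strictly convex on `ℝ`; in particular the
Turán-type inequality `K(λ, ω)² < K(λ+1, ω) K(λ−1, ω)` holds. -/
theorem besselK_strictConvexOn_index (ω : ℝ) (hω : 0 < ω) :
    StrictConvexOn ℝ Set.univ (fun lam => Real.log (besselK lam ω)) ∧
    ∀ lam : ℝ, besselK lam ω ^ 2 < besselK (lam + 1) ω * besselK (lam - 1) ω := by
  refine ⟨strictConvexOn_log_besselK hω, fun lam => ?_⟩
  have h := (strictConvexOn_log_besselK hω).2 (Set.mem_univ (lam + 1)) (Set.mem_univ (lam - 1))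
    (by linarith) (half_pos one_pos) (half_pos one_pos) (add_halves 1)
  simp only [smul_eq_mul] at h
  rw [show 1 / 2 * (lam + 1) + 1 / 2 * (lam - 1) = lam by ring] at h
  have hl := besselK_pos (lam + 1) hω
  have hr := besselK_pos (lam - 1) hω
  rw [← Real.log_lt_log_iff (pow_pos (besselK_pos lam hω) 2) (mul_pos hl hr), Real.log_pow,
    Real.log_mul hl.ne' hr.ne']
  push_cast
  linarith
end

section
/- Let p, n ≥ 1, x₁, …, xₙ ∈ ℝ^p, z₁, …, zₙ ≥ 0 with N = Σᵢ zᵢ > 0, b₁, …, bₙ > 0, μ, β ∈ ℝ^p, and let x̄ = (1/N) Σᵢ zᵢ xᵢ. Let ā ∈ ℝ satisfy ā ≥ (1/N) Σᵢ zᵢ/bᵢ. Define Σ̂ = (1/N) Σᵢ zᵢ bᵢ (xᵢ − μ)(xᵢ − μ)ᵀ − β(x̄ − μ)ᵀ − (x̄ − μ)βᵀ + ā ββᵀ and Σ* = (1/N) Σᵢ zᵢ bᵢ (xᵢ − μ − β/bᵢ)(xᵢ − μ − β/bᵢ)ᵀ. Then Σ̂ − Σ* is positive semidefinite and Σ* is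 positive semidefinite; in particular Σ̂ is positive semidefinite, and Σ̂ is positive definite whenever Σ* is positive definite. -/
open Matrix Finset

/-- Subtracting the completed square leaves a multiple of `β βᵀ`. -/
lemma scale_update_sub_completed_square {ι m : Type*} [Fintype ι]
    (x : ι → m → ℝ) (z b : ι → ℝ) (hN : ∑ i, z i ≠ 0) (hb : ∀ i, b i ≠ 0)
    (μ β : m → ℝ) (a : ℝ) :
    ((1 / ∑ i, z i) • ∑ i, (z i * b i) • vecMulVec (x i - μ) (x i - μ)
        - vecMulVec β ((1 / ∑ i, z i) • ∑ i, z i • x i - μ)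
        - vecMulVec ((1 / ∑ i, z i) • ∑ i, z i • x i - μ) β + a • vecMulVec β β)
      - (1 / ∑ i, z i) • ∑ i, (z i * b i) •
        vecMulVec (x i - μ - (b i)⁻¹ • β) (x i - μ - (b i)⁻¹ • β)
      = (a - (1 / ∑ i, z i) * ∑ i, z i / b i) • vecMulVec β β := by
  ext r s
  have key : ∑ i, z i * b i * ((x i r - μ r) * (x i s - μ s))
      - ∑ i, z i * b i * ((x i r - μ r - (b i)⁻¹ * β r) * (x i s - μ s - (b i)⁻¹ * β s))
      = β s * ∑ i, z i * x i r + β r * ∑ i, z i * x i s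
        - (β s * μ r + β r * μ s) * ∑ i, z i - β r * β s * ∑ i, z i / b i := by
    simp only [mul_sum, ← sum_sub_distrib, ← sum_add_distrib]
    refine sum_congr rfl fun i _ => ?_
    have := hb i
    field_simp
    ring
  simp only [Matrix.sub_apply, Matrix.add_apply, Matrix.smul_apply, Matrix.sum_apply,
    vecMulVec_apply, Pi.sub_apply, Pi.smul_apply, Finset.sum_apply, smul_eq_mul]
  linear_combination (1 / ∑ i, z i) * key
    - (β s * μ r + β r * μ s) * one_div_mul_cancel hN

lemma posSemidef_vecMulVec_self_real {m : Type*} [Fintype m] (v : m → ℝ) :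
    (vecMulVec v v).PosSemidef := by
  simpa using posSemidef_vecMulVec_self_star v

/-- Positive (semi)definiteness of the M-step scale-matrix update: with weights `z i ≥ 0`
summing to `N > 0`, `b i > 0`, weighted mean `x̄`, and `ā ≥ (1/N) Σᵢ zᵢ/bᵢ`, the update
`Σ̂ = (1/N) Σᵢ zᵢbᵢ(xᵢ−μ)(xᵢ−μ)ᵀ − β(x̄−μ)ᵀ − (x̄−μ)βᵀ + ā ββᵀ` dominates
`Σ* = (1/N) Σᵢ zᵢbᵢ(xᵢ−μ−β/bᵢ)(xᵢ−μ−β/bᵢ)ᵀ ⪰ 0`; hence `Σ̂` is positive semidefinite, and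
positive definite whenever `Σ*` is. -/
theorem sigma_update_posDef
    (p n : ℕ) (hp : 1 ≤ p) (hn : 1 ≤ n)
    (x : Fin n → (Fin p → ℝ)) (z : Fin n → ℝ) (hz : ∀ i, 0 ≤ z i)
    (N : ℝ) (hN : N = ∑ i, z i) (hNpos : 0 < N)
    (b : Fin n → ℝ) (hb : ∀ i, 0 < b i)
    (μ β : Fin p → ℝ)
    (xbar : Fin p → ℝ) (hxbar : xbar = (1 / N) • ∑ i, z i • x i)
    (abar : ℝ) (habar : (1 / N) * ∑ i, z i / b i ≤ abar)
    (Shat Sstar : Matrix (Fin p) (Fin p) ℝ)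
    (hShat : Shat =
      (1 / N) • ∑ i, (z i * b i) • vecMulVec (x i - μ) (x i - μ)
        - vecMulVec β (xbar - μ) - vecMulVec (xbar - μ) β + abar • vecMulVec β β)
    (hSstar : Sstar =
      (1 / N) • ∑ i, (z i * b i) •
        vecMulVec (x i - μ - (b i)⁻¹ • β) (x i - μ - (b i)⁻¹ • β)) :
    (Shat - Sstar).PosSemidef ∧ Sstar.PosSemidef ∧ Shat.PosSemidef ∧
      (Sstar.PosDef → Shat.PosDef) := by
  have hdiff : (Shat - Sstar).PosSemidef := by
    subst hN hxbar hShat hSstar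
    rw [scale_update_sub_completed_square x z b hNpos.ne' (fun i => (hb i).ne')]
    exact (posSemidef_vecMulVec_self_real β).smul (sub_nonneg.mpr habar)
  have hstar : Sstar.PosSemidef := by
    rw [hSstar]
    exact (posSemidef_sum _ fun i _ => (posSemidef_vecMulVec_self_real _).smul
      (mul_nonneg (hz i) (hb i).le)).smul (one_div_nonneg.mpr hNpos.le)
  refine ⟨hdiff, hstar, ?_, fun h => ?_⟩
  · simpa using hdiff.add hstar
  · simpa using h.posSemidef_add hdiff
end

section
/- For i = 1, 2 let g_i(x) = (1 + (x − μ_i)²/κ_i²)^{λ_i/2} · exp(−α_i |x − μ_i| + δ_i (x − μ_i)) with μ_i, λ_i ∈ ℝ, κ_i > 0, and α_i > |δ_i|. If α₁ − δ₁ > α₂ − δ₂, then g₁(x)/g₂(x) → 0 as x → +∞; and if α₁ + δ₁ > α₂ + δ₂, then g₁(x)/g₂(x) → 0 as x → −∞. -/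
open Filter Real

/-- The large-`|x|` asymptotic form of the univariate generalized hyperbolic density in the
`(μ, λ, κ, α, δ)` parameterization:
`g(x) = (1 + (x−μ)²/κ²)^(λ/2) exp(−α|x−μ| + δ(x−μ))`. -/
noncomputable def ghTail (μ lam κ α δ x : ℝ) : ℝ :=
  (1 + (x - μ) ^ 2 / κ ^ 2) ^ (lam / 2) * Real.exp (-α * |x - μ| + δ * (x - μ))

theorem log_one_add_sq_div_tendsto_zero (μ : ℝ) {κ : ℝ} (hκ : 0 < κ) :
    Tendsto (fun x : ℝ => Real.log (1 + (x - μ) ^ 2 / κ ^ 2) / x) atTop (nhds 0) := by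
  have haff : Tendsto (fun x : ℝ => 1 + (x - μ) / κ) atTop atTop :=
    tendsto_atTop_add_const_left _ _
      ((tendsto_atTop_add_const_right _ (-μ) tendsto_id).atTop_div_const hκ)
  have hlog : Tendsto (fun x : ℝ => Real.log (1 + (x - μ) / κ) / (1 + (x - μ) / κ))
      atTop (nhds 0) :=
    (Real.isLittleO_log_id_atTop.tendsto_div_nhds_zero).comp haff
  have hquot : Tendsto (fun x : ℝ => (1 - μ / κ) / x + 1 / κ) atTop (nhds (0 + 1 / κ)) :=
    (tendsto_const_nhds.div_atTop tendsto_id).add_const _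
  have hupper := (hlog.mul hquot).const_mul 2
  rw [zero_mul, mul_zero] at hupper
  refine squeeze_zero' ?_ ?_ hupper
  · filter_upwards [eventually_gt_atTop 0] with x hx
    have : 0 ≤ (x - μ) ^ 2 / κ ^ 2 := by positivity
    exact div_nonneg (Real.log_nonneg (by linarith)) hx.le
  · filter_upwards [eventually_gt_atTop 0, eventually_gt_atTop μ] with x hx hxμ
    have ht : 0 < (x - μ) / κ := div_pos (sub_pos.2 hxμ) hκ
    have hle : Real.log (1 + (x - μ) ^ 2 / κ ^ 2) ≤ 2 * Real.log (1 + (x - μ) / κ) := by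
      have hpow := Real.log_pow (1 + (x - μ) / κ) 2
      rw [Nat.cast_ofNat] at hpow
      rw [← div_pow, ← hpow]
      exact Real.log_le_log (by positivity) (by nlinarith)
    have haux : (1 - μ / κ) / x + 1 / κ = (1 + (x - μ) / κ) / x := by
      field_simp
      ring
    rw [haux, div_mul_div_cancel₀ (by positivity), ← mul_div_assoc]
    exact div_le_div_of_nonneg_right hle hx.le

theorem ghTail_eq_exp (μ lam κ α δ x : ℝ) :
    ghTail μ lam κ α δ x =
      Real.exp (Real.log (1 + (x - μ) ^ 2 / κ ^ 2) * (lam / 2)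
        + (-α * |x - μ| + δ * (x - μ))) := by
  have : 0 < 1 + (x - μ) ^ 2 / κ ^ 2 := by positivity
  rw [ghTail, Real.rpow_def_of_pos this, ← Real.exp_add]

theorem ghTail_neg (μ lam κ α δ x : ℝ) :
    ghTail μ lam κ α δ (-x) = ghTail (-μ) lam κ α (-δ) x := by
  have h : -x - μ = -(x - -μ) := by ring
  rw [ghTail, ghTail, h, neg_sq, abs_neg, mul_neg, neg_mul δ]

theorem log_ghTail_div_tendsto (μ lam α δ : ℝ) {κ : ℝ} (hκ : 0 < κ) :
    Tendsto (fun x => Real.log (ghTail μ lam κ α δ x) / x) atTop (nhds (δ - α)) := by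
  have hlog := (log_one_add_sq_div_tendsto_zero μ hκ).mul_const (lam / 2)
  have hlin : Tendsto (fun x : ℝ => (δ - α) - (δ - α) * μ / x) atTop (nhds ((δ - α) - 0)) :=
    (tendsto_const_nhds.div_atTop tendsto_id).const_sub _
  have h := hlog.add hlin
  rw [zero_mul, zero_add, sub_zero] at h
  refine h.congr' ?_
  filter_upwards [eventually_gt_atTop 0, eventually_gt_atTop μ] with x hx hxμ
  rw [ghTail_eq_exp, Real.log_exp, abs_of_pos (sub_pos.2 hxμ)]
  field_simp
  ring

theorem ghTail_ratio_tendsto_zero_atTop (μ₁ μ₂ lam₁ lam₂ : ℝ) {κ₁ κ₂ α₁ α₂ δ₁ δ₂ : ℝ}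
    (hκ₁ : 0 < κ₁) (hκ₂ : 0 < κ₂) (h : α₂ - δ₂ < α₁ - δ₁) :
    Tendsto (fun x => ghTail μ₁ lam₁ κ₁ α₁ δ₁ x / ghTail μ₂ lam₂ κ₂ α₂ δ₂ x)
      atTop (nhds 0) := by
  have hsub := (log_ghTail_div_tendsto μ₁ lam₁ α₁ δ₁ hκ₁).sub
    (log_ghTail_div_tendsto μ₂ lam₂ α₂ δ₂ hκ₂)
  have hbot := Real.tendsto_exp_atBot.comp (hsub.neg_mul_atTop (by linarith) tendsto_id)
  refine hbot.congr' ?_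
  filter_upwards [eventually_gt_atTop 0] with x hx
  simp only [Function.comp_apply, id_eq]
  rw [← sub_div, div_mul_cancel₀ _ hx.ne', Real.exp_sub, ghTail_eq_exp, ghTail_eq_exp,
    Real.log_exp, Real.log_exp]

/-- Tail-ratio limits for generalized hyperbolic tail functions: if `α₁ − δ₁ > α₂ − δ₂` then
`g₁/g₂ → 0` at `+∞`, and if `α₁ + δ₁ > α₂ + δ₂` then `g₁/g₂ → 0` at `−∞`. -/
theorem ghTail_ratio_tendsto_zero
    (μ₁ μ₂ lam₁ lam₂ κ₁ κ₂ α₁ α₂ δ₁ δ₂ : ℝ)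
    (hκ₁ : 0 < κ₁) (hκ₂ : 0 < κ₂)
    (hα₁ : |δ₁| < α₁) (hα₂ : |δ₂| < α₂) :
    (α₂ - δ₂ < α₁ - δ₁ →
      Tendsto (fun x => ghTail μ₁ lam₁ κ₁ α₁ δ₁ x / ghTail μ₂ lam₂ κ₂ α₂ δ₂ x)
        atTop (nhds 0)) ∧
    (α₂ + δ₂ < α₁ + δ₁ →
      Tendsto (fun x => ghTail μ₁ lam₁ κ₁ α₁ δ₁ x / ghTail μ₂ lam₂ κ₂ α₂ δ₂ x)
        atBot (nhds 0)) := by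
  refine ⟨ghTail_ratio_tendsto_zero_atTop μ₁ μ₂ lam₁ lam₂ hκ₁ hκ₂, fun h => ?_⟩
  have htop := ghTail_ratio_tendsto_zero_atTop (-μ₁) (-μ₂) lam₁ lam₂ hκ₁ hκ₂
    (show α₂ - -δ₂ < α₁ - -δ₁ by linarith)
  refine (htop.comp tendsto_neg_atBot_atTop).congr fun x => ?_
  simp only [Function.comp_apply]
  rw [← ghTail_neg, ← ghTail_neg, neg_neg]
end
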